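/- arXiv:2102.01320 — 3 statements merged into one kernel-verified Lean document; each statement's English description precedes it below -/
import Mathlib

section
/- A matroidal binary function is linear if and only if it has no minor isomorphic to the order-four binary function f_{U24} on ground set {a,b,c,d} with f_{U24}(X)=0 for |X| ∈ {1,2}, f_{U24}(X)=1 for |X| ∈ {0,3}, and f_{U24}(X)=−1 for |X|=4. -/
/-- A binary function on finite ground set `E`: a function `f : 2^E → ℝ` with `f ∅ = 1`.
(The function is defined on all finite sets; only its values on subsets of `E` matter.) -/
structure BinaryFunction (α : Type) [DecidableEq α] where
  E : Finset α
  f : Finset α → ℝ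
  empty_one : f ∅ = 1

namespace BinaryFunction

variable {α : Type} [DecidableEq α]

/-- Contraction of a single element: `(f/e)(Y) = f(Y)` on ground set `E ∖ {e}`. -/
def contract (g : BinaryFunction α) (e : α) : BinaryFunction α :=
  ⟨g.E.erase e, g.f, g.empty_one⟩

/-- Deletion of a single element: `(f∖e)(Y) = (f(Y) + f(Y ∪ {e})) / (1 + f({e}))`
on ground set `E ∖ {e}`; well defined iff `1 + f({e}) ≠ 0` (in which case the
`if` branch below agrees with the formula, since the formula gives `1` at `∅`). -/
noncomputable def delete (g : BinaryFunction α) (e : α) : BinaryFunction α :=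
  ⟨g.E.erase e,
   fun Y => if Y = ∅ then 1 else (g.f Y + g.f (Y ∪ {e})) / (1 + g.f {e}),
   by simp⟩

/-- Contraction of a set: `(f/X)(Y) = f(Y)` on ground set `E ∖ X`. -/
def contractSet (g : BinaryFunction α) (X : Finset α) : BinaryFunction α :=
  ⟨g.E \ X, g.f, g.empty_one⟩

/-- Deletion of a set: `(f∖X)(Y) = (∑_{Z ⊆ X} f(Y ∪ Z)) / (∑_{Z ⊆ X} f(Z))`
on ground set `E ∖ X`; well defined iff `∑_{Z ⊆ X} f(Z) ≠ 0` (in which case the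
`if` branch agrees with the formula, since the formula gives `1` at `∅`). -/
noncomputable def deleteSet (g : BinaryFunction α) (X : Finset α) : BinaryFunction α :=
  ⟨g.E \ X,
   fun Y => if Y = ∅ then 1 else
     (∑ Z ∈ X.powerset, g.f (Y ∪ Z)) / (∑ Z ∈ X.powerset, g.f Z),
   by simp⟩

/-- `IsMinorOf m f`: `m` is obtained from `f` by a sequence of single-element
contractions and deletions, each step being well defined. -/
inductive IsMinorOf : BinaryFunction α → BinaryFunction α → Prop
  | refl (f : BinaryFunction α) : IsMinorOf f f
  | contract {f g : BinaryFunction α} (e : α) (he : e ∈ g.E)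
      (h : IsMinorOf g f) : IsMinorOf (g.contract e) f
  | delete {f g : BinaryFunction α} (e : α) (he : e ∈ g.E)
      (hw : 1 + g.f {e} ≠ 0) (h : IsMinorOf g f) : IsMinorOf (g.delete e) f

/-- `f` is stable: every sequence of single-element contractions and deletions applied
to `f` is well defined at every step, i.e. at every reachable minor `g`, deletion of any
ground-set element is well defined. -/
def Stable (f : BinaryFunction α) : Prop :=
  ∀ g : BinaryFunction α, IsMinorOf g f → ∀ e ∈ g.E, 1 + g.f {e} ≠ 0

/-- Isomorphism of binary functions: a bijection `φ` of ground sets with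
`f(X) = f'(φ(X))` for all `X ⊆ E`. -/
def Isomorphic (g g' : BinaryFunction α) : Prop :=
  ∃ φ : α → α, Set.InjOn φ ↑g.E ∧ g.E.image φ = g'.E ∧
    ∀ X ⊆ g.E, g.f X = g'.f (X.image φ)

/-- `f_α`: the order-one binary function on ground set `{e}` with value `α` on `{e}`. -/
def fAlpha (e : α) (a : ℝ) : BinaryFunction α :=
  ⟨{e}, fun X => if X = ∅ then 1 else a, by simp⟩

/-- The rank function `Qf(X) = log₂((∑_{Y ⊆ E} f(Y)) / (∑_{Y ⊆ E∖X} f(Y)))`. -/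
noncomputable def Q (g : BinaryFunction α) (X : Finset α) : ℝ :=
  Real.logb 2 ((∑ Y ∈ g.E.powerset, g.f Y) / (∑ Y ∈ (g.E \ X).powerset, g.f Y))

/-- `f` is rankable: for every `X ⊆ E` the denominator in `Qf(X)` is nonzero and
the quotient is strictly positive. -/
def Rankable (g : BinaryFunction α) : Prop :=
  ∀ X ⊆ g.E, (∑ Y ∈ (g.E \ X).powerset, g.f Y) ≠ 0 ∧
    0 < (∑ Y ∈ g.E.powerset, g.f Y) / (∑ Y ∈ (g.E \ X).powerset, g.f Y)

/-- `f` is `k`-polymatroidal: rankable, with `Qf` satisfying R0–R3. -/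
def Polymatroidal (k : ℕ) (g : BinaryFunction α) : Prop :=
  Rankable g ∧
  (∀ X ⊆ g.E, ∃ n : ℕ, g.Q X = n) ∧
  (∀ X ⊆ g.E, g.Q X ≤ (k : ℝ) * X.card) ∧
  (∀ X ⊆ g.E, ∀ e ∈ g.E, e ∉ X → g.Q X ≤ g.Q (insert e X)) ∧
  (∀ X ⊆ g.E, ∀ a ∈ g.E, ∀ b ∈ g.E, a ∉ X → b ∉ X → a ≠ b →
    g.Q X + g.Q (insert a (insert b X)) ≤ g.Q (insert a X) + g.Q (insert b X))

/-- `f` is linear: `{0,1}`-valued on subsets of `E`, and closed under symmetric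
difference of supports. -/
def Linear (g : BinaryFunction α) : Prop :=
  (∀ X ⊆ g.E, g.f X = 0 ∨ g.f X = 1) ∧
  (∀ X ⊆ g.E, ∀ Y ⊆ g.E, g.f X = 1 → g.f Y = 1 → g.f (symmDiff X Y) = 1)

/-- The order-two excluded minor `g`: value `1` on sets of size `0,1`, `-1` on size `2`. -/
def gTwo (a b : α) : BinaryFunction α :=
  ⟨{a, b}, fun X => if X.card = 2 then -1 else 1, by simp⟩

/-- The order-four excluded minor `f_{U_{2,4}}`: `1` on sizes `0,3`, `0` on sizes `1,2`,
`-1` on size `4`. -/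
def fU24 (a b c d : α) : BinaryFunction α :=
  ⟨{a, b, c, d},
   fun X => if X.card = 0 then 1 else if X.card ≤ 2 then 0
            else if X.card = 3 then 1 else -1,
   by simp⟩

/-- The order-two excluded minors `f_{α,β,γ}` of the `k`-polymatroidal binary functions. -/
def fABG (a b : α) (p q r : ℕ) : BinaryFunction α :=
  ⟨{a, b},
   fun X =>
     if X = ∅ then 1
     else if X = {a} then 2 ^ (p + r - q + 1) - 1
     else if X = {b} then 2 ^ (r + 1) - 1
     else 2 ^ (p + r + 1) - 2 ^ (r + 1) - 2 ^ (p + r - q + 1) + 1,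
   by simp⟩

end BinaryFunction

namespace BinaryFunction

variable {α : Type} [DecidableEq α]

/-! ### Symmetric differences of finite sets -/

theorem symmDiff_subset_of_subset {E X Y : Finset α} (hX : X ⊆ E) (hY : Y ⊆ E) :
    symmDiff X Y ⊆ E := by
  grind [Finset.mem_symmDiff]

theorem symmDiff_singleton_of_mem {X : Finset α} {e : α} (he : e ∈ X) :
    symmDiff X {e} = X.erase e := by
  ext x; grind [Finset.mem_symmDiff]

theorem symmDiff_singleton_of_notMem {X : Finset α} {e : α} (he : e ∉ X) :
    symmDiff X {e} = insert e X := by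
  ext x; grind [Finset.mem_symmDiff]

theorem symmDiff_pair (X : Finset α) {a b : α} (hab : a ≠ b) :
    symmDiff X {a, b} = symmDiff (symmDiff X {a}) {b} := by
  ext x; grind [Finset.mem_symmDiff]

theorem erase_symmDiff_erase (X Y : Finset α) (e : α) :
    symmDiff (X.erase e) (Y.erase e) = (symmDiff X Y).erase e := by
  ext x; grind [Finset.mem_symmDiff]

theorem symmDiff_erase_erase {W : Finset α} {a b : α} (ha : a ∈ W) (hb : b ∈ W) (hab : a ≠ b) :
    symmDiff (W.erase a) (W.erase b) = {a, b} := by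
  ext x; grind [Finset.mem_symmDiff]

theorem symmDiff_triple_triple {a b c d : α} (hca : c ≠ a) (hcb : c ≠ b) (hda : d ≠ a)
    (hdb : d ≠ b) (hdc : d ≠ c) :
    symmDiff ({a, b, c} : Finset α) {a, b, d} = {c, d} := by
  ext x; grind [Finset.mem_symmDiff]

theorem insert_sdiff_insert_self {E S : Finset α} {e : α} (he : e ∈ E) (heS : e ∉ S) :
    insert e (E \ insert e S) = E \ S := by
  grind

/-! ### Minors -/

theorem IsMinorOf.trans {m g f : BinaryFunction α} (hmg : IsMinorOf m g) (hgf : IsMinorOf g f) :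
    IsMinorOf m f := by
  induction hmg with
  | refl => exact hgf
  | contract e he _ ih => exact .contract e he (ih hgf)
  | delete e he hw _ ih => exact .delete e he hw (ih hgf)

theorem delete_f (g : BinaryFunction α) {e : α} (hw : 1 + g.f {e} ≠ 0) (Y : Finset α) :
    (g.delete e).f Y = (g.f Y + g.f (insert e Y)) / (1 + g.f {e}) := by
  by_cases hY : Y = ∅
  · subst hY
    simp [delete, g.empty_one, div_self hw]
  · simp [delete, hY]

/-! ### Linear binary functions are closed under minors -/

theorem Linear.contract {g : BinaryFunction α} (hg : g.Linear) (e : α) :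
    (g.contract e).Linear :=
  ⟨fun X hX => hg.1 X (hX.trans (Finset.erase_subset e g.E)),
    fun X hX Y hY => hg.2 X (hX.trans (Finset.erase_subset e g.E)) Y
      (hY.trans (Finset.erase_subset e g.E))⟩

theorem Linear.f_symmDiff_eq {g : BinaryFunction α} (hg : g.Linear) {X Z : Finset α}
    (hX : X ⊆ g.E) (hZ : Z ⊆ g.E) (hf : g.f Z = 1) : g.f (symmDiff X Z) = g.f X := by
  have hXZ : symmDiff X Z ⊆ g.E := symmDiff_subset_of_subset hX hZ
  rcases hg.1 X hX with h | h
  · rcases hg.1 _ hXZ with h' | h'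
    · rw [h, h']
    · have := hg.2 _ hXZ Z hZ h' hf
      rw [symmDiff_symmDiff_cancel_right] at this
      rw [h', this]
  · rw [h, hg.2 X hX Z hZ h hf]

theorem Linear.delete {g : BinaryFunction α} (hg : g.Linear) {e : α} (he : e ∈ g.E) :
    (g.delete e).Linear := by
  have hes : ({e} : Finset α) ⊆ g.E := by simpa using he
  have hsub : ∀ {X}, X ⊆ g.E.erase e → X ⊆ g.E ∧ insert e X ⊆ g.E ∧
      insert e X = symmDiff X {e} := by
    intro X hX
    have heX : e ∉ X := fun h => Finset.notMem_erase e g.E (hX h)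
    have hXE := hX.trans (Finset.erase_subset e g.E)
    exact ⟨hXE, Finset.insert_subset he hXE, (symmDiff_singleton_of_notMem heX).symm⟩
  rcases hg.1 {e} hes with h0 | h1
  · have hf : ∀ Y, (g.delete e).f Y = g.f Y + g.f (insert e Y) := fun Y => by
      rw [delete_f g (by simp [h0]), h0]; simp
    have hone : ∀ {X}, X ⊆ g.E.erase e → g.f X = 1 → g.f (insert e X) = 0 := by
      intro X hX hX1
      obtain ⟨hXE, hXe, hins⟩ := hsub hX
      refine (hg.1 _ hXe).resolve_right fun h => ?_
      have := hg.2 X hXE _ hXe hX1 h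
      rw [hins, symmDiff_symmDiff_cancel_left, h0] at this
      exact zero_ne_one this
    have key : ∀ {X}, X ⊆ g.E.erase e → g.f X + g.f (insert e X) = 1 →
        ∃ X', X' ⊆ g.E ∧ g.f X' = 1 ∧ (X' = X ∨ X' = insert e X) := by
      intro X hX hs
      obtain ⟨hXE, hXe, -⟩ := hsub hX
      rcases hg.1 X hXE with h | h
      · exact ⟨_, hXe, by linarith, Or.inr rfl⟩
      · exact ⟨X, hXE, h, Or.inl rfl⟩
    have h01 : ∀ X ⊆ g.E.erase e, (g.delete e).f X = 0 ∨ (g.delete e).f X = 1 := by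
      intro X hX
      obtain ⟨hXE, hXe, -⟩ := hsub hX
      rw [hf]
      rcases hg.1 X hXE with h | h
      · simpa [h] using hg.1 _ hXe
      · simp [h, hone hX h]
    refine ⟨h01, fun X hX Y hY hX1 hY1 => ?_⟩
    have hXY : symmDiff X Y ⊆ g.E.erase e := symmDiff_subset_of_subset hX hY
    rw [hf] at hX1 hY1
    obtain ⟨X', hX'E, hX'1, hX'⟩ := key hX hX1
    obtain ⟨Y', hY'E, hY'1, hY'⟩ := key hY hY1
    have h := hg.2 X' hX'E Y' hY'E hX'1 hY'1
    have heXY : insert e (symmDiff X Y) = symmDiff (symmDiff X Y) {e} := (hsub hXY).2.2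
    have : symmDiff X' Y' = symmDiff X Y ∨ symmDiff X' Y' = insert e (symmDiff X Y) := by
      rw [heXY]
      rw [(hsub hX).2.2] at hX'
      rw [(hsub hY).2.2] at hY'
      rcases hX' with rfl | rfl <;> rcases hY' with rfl | rfl
      · exact Or.inl rfl
      · right; rw [symmDiff_assoc]
      · right; rw [symmDiff_assoc, symmDiff_assoc, symmDiff_comm ({e} : Finset α)]
      · left; rw [symmDiff_symmDiff_symmDiff_comm, symmDiff_self]; simp
    refine (h01 _ hXY).resolve_left fun h' => ?_
    obtain ⟨hE, hEe, -⟩ := hsub hXY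
    rw [hf] at h'
    have a1 := hg.1 _ hE
    have a2 := hg.1 _ hEe
    rcases this with h2 | h2 <;> rw [h2] at h <;> rcases a1 with a1 | a1 <;>
      rcases a2 with a2 | a2 <;> linarith
  · have hf : ∀ Y ⊆ g.E.erase e, (g.delete e).f Y = g.f Y := fun Y hY => by
      obtain ⟨hYE, -, hins⟩ := hsub hY
      rw [delete_f g (by rw [h1]; norm_num), h1, hins, hg.f_symmDiff_eq hYE hes h1]
      ring
    refine ⟨fun X hX => ?_, fun X hX Y hY hX1 hY1 => ?_⟩
    · rw [hf X hX]
      exact hg.1 X (hsub hX).1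
    · have hXY : symmDiff X Y ⊆ g.E.erase e := symmDiff_subset_of_subset hX hY
      rw [hf X hX] at hX1
      rw [hf Y hY] at hY1
      rw [hf _ hXY]
      exact hg.2 X (hsub hX).1 Y (hsub hY).1 hX1 hY1

theorem Linear.of_isMinorOf {m g : BinaryFunction α} (h : IsMinorOf m g) (hg : g.Linear) :
    m.Linear := by
  induction h with
  | refl => exact hg
  | contract e _ _ ih => exact (ih hg).contract e
  | delete e he _ _ ih => exact (ih hg).delete he

theorem Linear.not_isomorphic_fU24 {m : BinaryFunction α} (hm : m.Linear) {a b c d : α}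
    (hcard : ({a, b, c, d} : Finset α).card = 4) : ¬ m.Isomorphic (fU24 a b c d) := by
  rintro ⟨φ, -, hE, hf⟩
  have h := hf m.E subset_rfl
  rw [hE] at h
  have h' : (fU24 a b c d).f (fU24 a b c d).E = -1 := by simp [fU24, hcard]
  rw [h'] at h
  rcases hm.1 m.E subset_rfl with h0 | h0 <;> norm_num [h0] at h

/-! ### The combinatorial content of being matroidal -/

/-- The sum of `g.f` over all subsets of `S`. -/
def subsetSum (g : BinaryFunction α) (S : Finset α) : ℝ :=
  ∑ Y ∈ S.powerset, g.f Y

/-- The subset sums are positive, adding an element either preserves or doubles them, and an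
element that doubles one subset sum also doubles the larger ones. -/
structure Doubling (g : BinaryFunction α) : Prop where
  pos : ∀ S ⊆ g.E, 0 < g.subsetSum S
  step : ∀ S ⊆ g.E, ∀ e ∈ g.E, e ∉ S →
    g.subsetSum (insert e S) = g.subsetSum S ∨ g.subsetSum (insert e S) = 2 * g.subsetSum S
  mono : ∀ S ⊆ g.E, ∀ a ∈ g.E, ∀ b ∈ g.E, a ∉ S → b ∉ S → a ≠ b →
    g.subsetSum (insert a S) = 2 * g.subsetSum S →
    g.subsetSum (insert a (insert b S)) = 2 * g.subsetSum (insert b S)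

theorem subsetSum_empty (g : BinaryFunction α) : g.subsetSum ∅ = 1 := by
  simp [subsetSum, g.empty_one]

theorem subsetSum_insert (g : BinaryFunction α) {e : α} {S : Finset α} (he : e ∉ S) :
    g.subsetSum (insert e S) = g.subsetSum S + ∑ Y ∈ S.powerset, g.f (insert e Y) :=
  Finset.sum_powerset_insert he g.f

theorem subsetSum_singleton (g : BinaryFunction α) (e : α) :
    g.subsetSum {e} = 1 + g.f {e} := by
  have h := g.subsetSum_insert (Finset.notMem_empty e)
  simpa [subsetSum_empty] using h

theorem subsetSum_delete (g : BinaryFunction α) {e : α} (hw : 1 + g.f {e} ≠ 0) {S : Finset α}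
    (he : e ∉ S) : (g.delete e).subsetSum S = g.subsetSum (insert e S) / (1 + g.f {e}) := by
  rw [subsetSum_insert g he, subsetSum, subsetSum, ← Finset.sum_add_distrib, Finset.sum_div]
  exact Finset.sum_congr rfl fun Y _ => delete_f g hw Y

theorem Doubling.contract {g : BinaryFunction α} (hg : g.Doubling) (e : α) :
    (g.contract e).Doubling := by
  have hE : (g.contract e).E ⊆ g.E := Finset.erase_subset e g.E
  exact ⟨fun S hS => hg.pos S (hS.trans hE), fun S hS a ha => hg.step S (hS.trans hE) a (hE ha),
    fun S hS a ha b hb => hg.mono S (hS.trans hE) a (hE ha) b (hE hb)⟩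

theorem Doubling.one_add_pos {g : BinaryFunction α} (hg : g.Doubling) {e : α} (he : e ∈ g.E) :
    0 < 1 + g.f {e} := by
  rw [← subsetSum_singleton]
  exact hg.pos {e} (by simpa using he)

theorem Doubling.delete {g : BinaryFunction α} (hg : g.Doubling) {e : α} (he : e ∈ g.E) :
    (g.delete e).Doubling := by
  have hpos := hg.one_add_pos he
  have hsum : ∀ S, e ∉ S → (g.delete e).subsetSum S = g.subsetSum (insert e S) / (1 + g.f {e}) :=
    fun S hS => subsetSum_delete g hpos.ne' hS
  have hmem : ∀ {a}, a ∈ (g.delete e).E → a ≠ e ∧ a ∈ g.E := fun h => Finset.mem_erase.1 h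
  have hsub : ∀ {S}, S ⊆ (g.delete e).E → e ∉ S ∧ insert e S ⊆ g.E := fun {S} hS =>
    ⟨fun h => (hmem (hS h)).1 rfl,
      Finset.insert_subset he fun x hx => (hmem (hS hx)).2⟩
  refine ⟨fun S hS => ?_, fun S hS a ha haS => ?_, fun S hS a ha b hb haS hbS hab h => ?_⟩
  · obtain ⟨heS, hSE⟩ := hsub hS
    rw [hsum S heS]
    exact div_pos (hg.pos _ hSE) hpos
  · obtain ⟨heS, hSE⟩ := hsub hS
    obtain ⟨hae, haE⟩ := hmem ha
    rw [hsum S heS, hsum _ (by grind), Finset.insert_comm]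
    rcases hg.step _ hSE a haE (by grind) with h | h <;> rw [h]
    · exact Or.inl rfl
    · exact Or.inr (by ring)
  · obtain ⟨heS, hSE⟩ := hsub hS
    obtain ⟨hae, haE⟩ := hmem ha
    obtain ⟨hbe, hbE⟩ := hmem hb
    rw [hsum S heS, hsum _ (by grind), Finset.insert_comm, ← mul_div_assoc,
      div_left_inj' hpos.ne'] at h
    rw [hsum _ (by grind), hsum _ (by grind), Finset.insert_comm e a, Finset.insert_comm e b,
      hg.mono _ hSE a haE b hbE (by grind) (by grind) hab h]
    ring

theorem Doubling.f_singleton {g : BinaryFunction α} (hg : g.Doubling) {e : α} (he : e ∈ g.E) :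
    g.f {e} = 0 ∨ g.f {e} = 1 := by
  have h := hg.step ∅ (Finset.empty_subset _) e he (Finset.notMem_empty e)
  rw [insert_empty_eq, subsetSum_singleton, subsetSum_empty] at h
  rcases h with h | h
  · left; linarith
  · right; linarith

/-- An element `e` with `g.f {e} = 1` doubles every subset sum. -/
theorem Doubling.subsetSum_insert_of_loop {g : BinaryFunction α} (hg : g.Doubling) {e : α}
    (he : e ∈ g.E) (h1 : g.f {e} = 1) (S : Finset α) (hS : S ⊆ g.E) (heS : e ∉ S) :
    g.subsetSum (insert e S) = 2 * g.subsetSum S := by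
  induction S using Finset.induction_on with
  | empty =>
    rw [insert_empty_eq, subsetSum_singleton, subsetSum_empty, h1]; norm_num
  | insert b S hbS ih =>
    exact hg.mono S (by grind) e he b (by grind) (by grind) hbS (by grind)
      (ih (by grind) (by grind))

theorem Doubling.f_insert_of_loop {g : BinaryFunction α} (hg : g.Doubling) {e : α}
    (he : e ∈ g.E) (h1 : g.f {e} = 1) (S : Finset α) (hS : S ⊆ g.E) (heS : e ∉ S) :
    g.f (insert e S) = g.f S := by
  induction S using Finset.strongInduction with
  | H S ih =>
    have h := hg.subsetSum_insert_of_loop he h1 S hS heS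
    rw [subsetSum_insert g heS, two_mul, add_right_inj, subsetSum,
      ← Finset.insert_erase (Finset.mem_powerset_self S),
      Finset.sum_insert (Finset.notMem_erase _ _), Finset.sum_insert (Finset.notMem_erase _ _),
      Finset.sum_congr rfl (g := g.f)] at h
    · exact add_right_cancel h
    · intro Y hY
      rw [Finset.mem_erase, Finset.mem_powerset] at hY
      exact ih Y (hY.2.ssubset_of_ne hY.1) (hY.2.trans hS) fun h => heS (hY.2 h)

theorem Polymatroidal.doubling {g : BinaryFunction α} (hg : g.Polymatroidal 1) :
    g.Doubling := by
  obtain ⟨hrank, hR0, hR1, hR2, hR3⟩ := hg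
  have hratio : ∀ X ⊆ g.E, g.subsetSum g.E = 2 ^ g.Q X * g.subsetSum (g.E \ X) := by
    intro X hX
    obtain ⟨hne, hpos⟩ := hrank X hX
    rw [Q, Real.rpow_logb (by norm_num) (by norm_num) hpos]
    exact (div_mul_cancel₀ _ hne).symm
  have hQ0 : g.Q ∅ = 0 := by
    have h := (hrank ∅ (Finset.empty_subset _)).1
    simp only [Finset.sdiff_empty] at h
    simp [Q, div_self h]
  have hEpos : 0 < g.subsetSum g.E := by
    rw [hratio g.E subset_rfl, Finset.sdiff_self, subsetSum_empty]
    positivity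
  have hsum : ∀ S ⊆ g.E, g.subsetSum g.E = 2 ^ g.Q (g.E \ S) * g.subsetSum S := by
    intro S hS
    rw [hratio (g.E \ S) Finset.sdiff_subset, Finset.sdiff_sdiff_eq_self hS]
  have hunit : ∀ X ⊆ g.E, ∀ e ∈ g.E, e ∉ X → g.Q (insert e X) ≤ g.Q X + 1 := by
    intro X hX e he heX
    induction X using Finset.induction_on with
    | empty => simpa [hQ0] using hR1 {e} (by simpa using he)
    | insert b X hbX ih =>
      have h1 := hR3 X (by grind) e he b (by grind) (by grind) hbX (by grind)
      have h2 := ih (by grind) (by grind)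
      linarith
  have hstep : ∀ X ⊆ g.E, ∀ e ∈ g.E, e ∉ X →
      g.Q (insert e X) = g.Q X ∨ g.Q (insert e X) = g.Q X + 1 := by
    intro X hX e he heX
    have h1 := hunit X hX e he heX
    have h2 := hR2 X hX e he heX
    obtain ⟨m, hm⟩ := hR0 X hX
    obtain ⟨n, hn⟩ := hR0 (insert e X) (by grind)
    rw [hm, hn] at h1 h2 ⊢
    norm_cast at h1 h2 ⊢
    omega
  have hpow : ∀ x : ℝ, (2 : ℝ) ^ (x + 1) = 2 * 2 ^ x := fun x => by
    rw [Real.rpow_add (by norm_num), Real.rpow_one, mul_comm]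
  have hsame : ∀ {S T}, S ⊆ g.E → T ⊆ g.E → g.Q (g.E \ S) = g.Q (g.E \ T) →
      g.subsetSum T = g.subsetSum S := by
    intro S T hS hT h
    have h1 := hsum S hS
    rw [hsum T hT, h] at h1
    exact mul_left_cancel₀ (Real.rpow_pos_of_pos (by norm_num) _).ne' h1
  have htwice : ∀ {S T}, S ⊆ g.E → T ⊆ g.E → g.Q (g.E \ S) = g.Q (g.E \ T) + 1 →
      g.subsetSum T = 2 * g.subsetSum S := by
    intro S T hS hT h
    have h1 := hsum S hS
    rw [hsum T hT, h, hpow, mul_comm 2, mul_assoc] at h1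
    exact mul_left_cancel₀ (Real.rpow_pos_of_pos (by norm_num) _).ne' h1
  have hpos : ∀ S ⊆ g.E, 0 < g.subsetSum S := by
    intro S hS
    rw [hsum S hS] at hEpos
    exact pos_of_mul_pos_right hEpos (by positivity)
  refine ⟨hpos, fun S hS e he heS => ?_, fun S hS a ha b hb haS hbS hab h => ?_⟩
  · have h := hstep (g.E \ insert e S) Finset.sdiff_subset e he (by simp)
    have hSe : insert e S ⊆ g.E := Finset.insert_subset he hS
    rw [insert_sdiff_insert_self he heS] at h
    exact h.imp (hsame hS hSe) (htwice hS hSe)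
  · have hSa : insert a S ⊆ g.E := Finset.insert_subset ha hS
    have hSb : insert b S ⊆ g.E := Finset.insert_subset hb hS
    have haSb : a ∉ insert b S := by simp [hab, haS]
    have hbSa : b ∉ insert a S := by simp [hab.symm, hbS]
    have hX : g.E \ insert a (insert b S) ⊆ g.E := Finset.sdiff_subset
    have hXa := insert_sdiff_insert_self ha haSb
    have hXb := insert_sdiff_insert_self hb hbSa
    rw [Finset.insert_comm b a] at hXb
    have hXab := insert_sdiff_insert_self ha haS
    have h3 := hR3 _ hX a ha b hb (by simp) (by simp) hab
    have h1 := hstep _ hX a ha (by simp)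
    have h2 := hstep (g.E \ insert a S) Finset.sdiff_subset a ha (by simp)
    rw [hXa] at h1
    rw [hXab] at h2
    rw [hXb, hXa, hXab] at h3
    refine htwice hSb (Finset.insert_subset ha hSb) (h1.resolve_left fun h1 => ?_)
    rcases h2 with h2 | h2
    · have := hsame hS hSa h2
      linarith [hpos S hS]
    · linarith

/-! ### Binary functions all of whose single-element minors are linear -/

/-- Translation invariance by a nonempty set reduces linearity to a contraction. -/
theorem linear_of_invariant {g : BinaryFunction α} {Z : Finset α} {e : α} (hZ : Z ⊆ g.E)
    (he : e ∈ Z) (hinv : ∀ X ⊆ g.E, g.f (symmDiff X Z) = g.f X)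
    (hlin : (g.contract e).Linear) : g.Linear := by
  have key : ∀ X ⊆ g.E, ∃ X' ⊆ g.E.erase e, g.f X' = g.f X ∧ (X' = X ∨ X' = symmDiff X Z) := by
    intro X hX
    by_cases h : e ∈ X
    · exact ⟨symmDiff X Z, Finset.subset_erase.2 ⟨symmDiff_subset_of_subset hX hZ,
        by simp [Finset.mem_symmDiff, h, he]⟩, hinv X hX, Or.inr rfl⟩
    · exact ⟨X, Finset.subset_erase.2 ⟨hX, h⟩, rfl, Or.inl rfl⟩
  refine ⟨fun X hX => ?_, fun X hX Y hY hX1 hY1 => ?_⟩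
  · obtain ⟨X', hX', hf, -⟩ := key X hX
    rw [← hf]
    exact hlin.1 X' hX'
  · obtain ⟨X', hX'E, hfX, hX'⟩ := key X hX
    obtain ⟨Y', hY'E, hfY, hY'⟩ := key Y hY
    have h : g.f (symmDiff X' Y') = 1 :=
      hlin.2 X' hX'E Y' hY'E (hfX.trans hX1) (hfY.trans hY1)
    have hXY : symmDiff X Y ⊆ g.E := symmDiff_subset_of_subset hX hY
    have : symmDiff X' Y' = symmDiff X Y ∨ symmDiff X' Y' = symmDiff (symmDiff X Y) Z := by
      rcases hX' with rfl | rfl <;> rcases hY' with rfl | rfl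
      · exact Or.inl rfl
      · right; rw [symmDiff_assoc]
      · right; rw [symmDiff_assoc, symmDiff_assoc, symmDiff_comm Z]
      · left; rw [symmDiff_symmDiff_symmDiff_comm, symmDiff_self]; simp
    rcases this with h' | h'
    · rwa [h'] at h
    · rwa [h', hinv _ hXY] at h

theorem Doubling.linear_of_loop {g : BinaryFunction α} (hg : g.Doubling) {e : α} (he : e ∈ g.E)
    (h1 : g.f {e} = 1) (hlin : (g.contract e).Linear) : g.Linear := by
  refine linear_of_invariant (Z := {e}) (by simpa using he) (Finset.mem_singleton_self e)
    (fun X hX => ?_) hlin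
  by_cases h : e ∈ X
  · rw [symmDiff_singleton_of_mem h, ← hg.f_insert_of_loop he h1 (X.erase e)
      ((Finset.erase_subset e X).trans hX) (Finset.notMem_erase e X), Finset.insert_erase h]
  · rw [symmDiff_singleton_of_notMem h, hg.f_insert_of_loop he h1 X hX h]

theorem delete_f_of_zero (g : BinaryFunction α) {e : α} (h0 : g.f {e} = 0) (Y : Finset α) :
    (g.delete e).f Y = g.f Y + g.f (insert e Y) := by
  rw [delete_f g (by simp [h0]), h0]; simp

theorem linear_of_parallel {g : BinaryFunction α} {a b : α} (ha : a ∈ g.E) (hb : b ∈ g.E)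
    (hab : a ≠ b) (ha0 : g.f {a} = 0) (hb0 : g.f {b} = 0) (h1 : g.f {a, b} = 1)
    (hda : (g.delete a).Linear) (hdb : (g.delete b).Linear) (hlin : (g.contract a).Linear) :
    g.Linear := by
  have hloop : ∀ {a b : α}, b ∈ g.E → a ≠ b → g.f {a} = 0 → g.f {b} = 0 → g.f {a, b} = 1 →
      (g.delete a).Linear → ∀ Y ⊆ g.E, a ∉ Y →
      g.f (symmDiff Y {b}) + g.f (symmDiff (symmDiff Y {b}) {a}) =
        g.f Y + g.f (symmDiff Y {a}) := by
    intro a b hb hab ha0 hb0 h1 hd Y hY haY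
    have h := hd.f_symmDiff_eq (X := Y) (Z := {b}) (Finset.subset_erase.2 ⟨hY, haY⟩)
      (Finset.singleton_subset_iff.2 (Finset.mem_erase.2 ⟨hab.symm, hb⟩))
      (by rw [delete_f_of_zero g ha0, hb0, h1]; norm_num)
    have haY' : a ∉ symmDiff Y {b} := by simp [Finset.mem_symmDiff, haY, hab]
    rwa [delete_f_of_zero g ha0, delete_f_of_zero g ha0, ← symmDiff_singleton_of_notMem haY,
      ← symmDiff_singleton_of_notMem haY'] at h
  have hab' : ∀ Y : Finset α,
      symmDiff (symmDiff Y {b}) {a} = symmDiff (symmDiff Y {a}) {b} := fun Y => by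
    rw [symmDiff_assoc, symmDiff_assoc, symmDiff_comm ({a} : Finset α)]
  have hloop_ab : ∀ Y ⊆ g.E,
      g.f (symmDiff Y {b}) + g.f (symmDiff (symmDiff Y {a}) {b}) =
        g.f Y + g.f (symmDiff Y {a}) := by
    intro Y hY
    by_cases haY : a ∈ Y
    · have h := hloop hb hab ha0 hb0 h1 hda (symmDiff Y {a})
        (symmDiff_subset_of_subset hY (by simpa using ha)) (by simp [Finset.mem_symmDiff, haY])
      rw [hab', symmDiff_symmDiff_cancel_right] at h
      linarith
    · rw [← hab']
      exact hloop hb hab ha0 hb0 h1 hda Y hY haY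
  have hloop_ba : ∀ Y ⊆ g.E,
      g.f (symmDiff Y {a}) + g.f (symmDiff (symmDiff Y {a}) {b}) =
        g.f Y + g.f (symmDiff Y {b}) := by
    intro Y hY
    rw [Finset.pair_comm] at h1
    by_cases hbY : b ∈ Y
    · have h := hloop ha hab.symm hb0 ha0 h1 hdb (symmDiff Y {b})
        (symmDiff_subset_of_subset hY (by simpa using hb)) (by simp [Finset.mem_symmDiff, hbY])
      rw [← hab' (symmDiff Y {b}), symmDiff_symmDiff_cancel_right, hab'] at h
      linarith
    · exact hloop ha hab.symm hb0 ha0 h1 hdb Y hY hbY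
  refine linear_of_invariant (Z := {a, b}) (by simp [Finset.insert_subset_iff, ha, hb])
    (Finset.mem_insert_self a {b}) (fun X hX => ?_) hlin
  rw [symmDiff_pair X hab]
  linarith [hloop_ab X hX, hloop_ba X hX]

/-- With no loops and no parallel pairs, if the full ground set has value `0` or `1` and all
single-element minors are linear, then so is `g`. -/
theorem linear_of_simple {g : BinaryFunction α} (hloop : ∀ a ∈ g.E, g.f {a} = 0)
    (hpar : ∀ a ∈ g.E, ∀ b ∈ g.E, a ≠ b → g.f {a, b} = 0)
    (hc : ∀ e ∈ g.E, (g.contract e).Linear) (hd : ∀ e ∈ g.E, (g.delete e).Linear)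
    (hE : g.f g.E = 0 ∨ g.f g.E = 1) : g.Linear := by
  have h01 : ∀ X ⊆ g.E, g.f X = 0 ∨ g.f X = 1 := by
    intro X hX
    by_cases h : X = g.E
    · rwa [h]
    · obtain ⟨e, he, heX⟩ := Finset.exists_of_ssubset (hX.ssubset_of_ne h)
      exact (hc e he).1 X (Finset.subset_erase.2 ⟨hX, heX⟩)
  have hdel_one : ∀ e ∈ g.E, ∀ X ⊆ g.E, e ∉ X → g.f X = 1 ∨ g.f (insert e X) = 1 →
      (g.delete e).f X = 1 := by
    intro e he X hX heX h
    have h1 := (hd e he).1 X (Finset.subset_erase.2 ⟨hX, heX⟩)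
    rw [delete_f_of_zero g (hloop e he)] at h1 ⊢
    refine h1.resolve_left fun h0 => ?_
    rcases h01 X hX with h2 | h2 <;>
      rcases h01 (insert e X) (Finset.insert_subset he hX) with h3 | h3 <;>
      simp [h2, h3] at h h0
  have hsum_one : ∀ e ∈ g.E, ∀ X ⊆ g.E, ∀ Y ⊆ g.E, g.f X = 1 → g.f Y = 1 →
      g.f ((symmDiff X Y).erase e) + g.f (insert e (symmDiff X Y)) = 1 := by
    intro e he X hX Y hY hX1 hY1
    have hone : ∀ X ⊆ g.E, g.f X = 1 → (g.delete e).f (X.erase e) = 1 := by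
      intro X hX hX1
      refine hdel_one e he _ ((Finset.erase_subset e X).trans hX) (by simp) ?_
      by_cases h : e ∈ X
      · right; rwa [Finset.insert_erase h]
      · left; rwa [Finset.erase_eq_of_notMem h]
    have h := (hd e he).2 (X.erase e) (Finset.erase_subset_erase e hX) (Y.erase e)
      (Finset.erase_subset_erase e hY) (hone X hX hX1) (hone Y hY hY1)
    have h3 : insert e ((symmDiff X Y).erase e) = insert e (symmDiff X Y) := by
      ext x; by_cases hx : x = e <;> simp [hx]
    rwa [erase_symmDiff_erase, delete_f_of_zero g (hloop e he), h3] at h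
  have herase : ∀ X ⊆ g.E, ∀ Y ⊆ g.E, g.f X = 1 → g.f Y = 1 → g.f (symmDiff X Y) = 0 →
      ∀ e ∈ symmDiff X Y, g.f ((symmDiff X Y).erase e) = 1 := by
    intro X hX Y hY hX1 hY1 h0 e he
    have h := hsum_one e (symmDiff_subset_of_subset hX hY he) X hX Y hY hX1 hY1
    rwa [Finset.insert_eq_of_mem he, h0, add_zero] at h
  have hmeet : ∀ X ⊆ g.E, ∀ Y ⊆ g.E, ∀ z ∈ X, z ∈ Y → g.f X = 1 → g.f Y = 1 →
      g.f (symmDiff X Y) = 1 := by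
    intro X hX Y hY z hzX hzY hX1 hY1
    have hWE : symmDiff X Y ⊆ g.E := symmDiff_subset_of_subset hX hY
    have hzW : z ∉ symmDiff X Y := by simp [Finset.mem_symmDiff, hzX, hzY]
    refine (h01 _ hWE).resolve_left fun h0 => ?_
    have her := herase X hX Y hY hX1 hY1 h0
    have hz := hsum_one z (hX hzX) X hX Y hY hX1 hY1
    generalize symmDiff X Y = W at *
    rw [Finset.erase_eq_of_notMem hzW, h0, zero_add] at hz
    have hne : W.Nonempty := by
      rw [Finset.nonempty_iff_ne_empty]
      rintro rfl
      exact one_ne_zero (g.empty_one.symm.trans h0)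
    obtain ⟨e, he⟩ := hne
    by_cases hW : W = {e}
    · have h1 := hpar z (hX hzX) e (hWE he) fun h => hzW (h ▸ he)
      rw [hW, h1] at hz
      exact zero_ne_one hz
    · obtain ⟨e', he', hne'⟩ : ∃ e' ∈ W, e' ≠ e := by
        by_contra! h
        exact hW (Finset.eq_singleton_iff_unique_mem.2 ⟨he, h⟩)
      have hWz : W ⊆ g.E.erase z := Finset.subset_erase.2 ⟨hWE, hzW⟩
      have h1 := (hc z (hX hzX)).2 (W.erase e) ((Finset.erase_subset e W).trans hWz)
        (W.erase e') ((Finset.erase_subset e' W).trans hWz) (her e he) (her e' he')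
      rw [symmDiff_erase_erase he he' hne'.symm] at h1
      exact one_ne_zero (h1.symm.trans (hpar e (hWE he) e' (hWE he') hne'.symm))
  refine ⟨h01, fun X hX Y hY hX1 hY1 => ?_⟩
  by_cases hmt : ∃ z ∈ X, z ∈ Y
  · obtain ⟨z, hzX, hzY⟩ := hmt
    exact hmeet X hX Y hY z hzX hzY hX1 hY1
  rcases X.eq_empty_or_nonempty with rfl | ⟨a, ha⟩
  · rwa [← Finset.bot_eq_empty, bot_symmDiff]
  rcases Y.eq_empty_or_nonempty with rfl | ⟨b, hb⟩
  · rwa [← Finset.bot_eq_empty, symmDiff_bot]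
  have haY : a ∉ Y := fun h => hmt ⟨a, ha, h⟩
  have hbX : b ∉ X := fun h => hmt ⟨b, h, hb⟩
  have hab : a ≠ b := fun h => hbX (h ▸ ha)
  have haW : a ∈ symmDiff X Y := Finset.mem_symmDiff.2 (Or.inl ⟨ha, haY⟩)
  have hbW : b ∈ symmDiff X Y := Finset.mem_symmDiff.2 (Or.inr ⟨hb, hbX⟩)
  have hWE : symmDiff X Y ⊆ g.E := symmDiff_subset_of_subset hX hY
  refine (h01 _ hWE).resolve_left fun h0 => ?_
  have her := herase X hX Y hY hX1 hY1 h0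
  generalize symmDiff X Y = W at *
  by_cases hW : ∃ c ∈ W, c ≠ a ∧ c ≠ b
  · obtain ⟨c, hcW, hca, hcb⟩ := hW
    have h1 := hmeet (W.erase a) ((Finset.erase_subset a W).trans hWE) (W.erase b)
      ((Finset.erase_subset b W).trans hWE) c (Finset.mem_erase.2 ⟨hca, hcW⟩)
      (Finset.mem_erase.2 ⟨hcb, hcW⟩) (her a haW) (her b hbW)
    rw [symmDiff_erase_erase haW hbW hab] at h1
    exact one_ne_zero (h1.symm.trans (hpar a (hWE haW) b (hWE hbW) hab))
  · have h1 := her a haW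
    have h2 : W.erase a = {b} := by
      push Not at hW
      exact Finset.eq_singleton_iff_unique_mem.2 ⟨Finset.mem_erase.2 ⟨hab.symm, hbW⟩,
        fun x hx => hW x (Finset.mem_of_mem_erase hx) (Finset.ne_of_mem_erase hx)⟩
    rw [h2, hloop b (hWE hbW)] at h1
    exact zero_ne_one h1

/-- With no loops and no parallel pairs, if all single-element minors are linear and the full
ground set has a value other than `0` and `1`, then `g` is `fU24`. -/
theorem isomorphic_fU24_of_simple {g : BinaryFunction α} (hloop : ∀ a ∈ g.E, g.f {a} = 0)
    (hpar : ∀ a ∈ g.E, ∀ b ∈ g.E, a ≠ b → g.f {a, b} = 0)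
    (hc : ∀ e ∈ g.E, (g.contract e).Linear) (hd : ∀ e ∈ g.E, (g.delete e).Linear)
    (hE : ¬ (g.f g.E = 0 ∨ g.f g.E = 1)) :
    ∃ a b c d : α, ({a, b, c, d} : Finset α).card = 4 ∧ g.Isomorphic (fU24 a b c d) := by
  have hco : ∀ e ∈ g.E, g.f (g.E.erase e) = 1 ∧ g.f g.E = -1 := by
    intro e he
    have h1 := (hc e he).1 (g.E.erase e) subset_rfl
    have h2 := (hd e he).1 (g.E.erase e) subset_rfl
    rw [delete_f_of_zero g (hloop e he), Finset.insert_erase he] at h2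
    simp only [contract] at h1
    push Not at hE
    rcases h1 with h1 | h1 <;> rw [h1] at h2 <;> rcases h2 with h2 | h2
    · exact absurd (by linarith) hE.1
    · exact absurd (by linarith) hE.2
    · exact ⟨h1, by linarith⟩
    · exact absurd (by linarith) hE.1
  have hcopair : ∀ e ∈ g.E, ∀ a ∈ g.E, a ≠ e → (g.delete e).f ((g.E.erase e).erase a) = 1 := by
    intro e he a ha hae
    have h1 := (hd e he).1 ((g.E.erase e).erase a) (Finset.erase_subset _ _)
    have h2 := (hc e he).1 ((g.E.erase e).erase a) (Finset.erase_subset _ _)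
    have h3 : insert e ((g.E.erase e).erase a) = g.E.erase a := by
      rw [Finset.erase_right_comm, Finset.insert_erase (Finset.mem_erase.2 ⟨hae.symm, he⟩)]
    simp only [contract] at h2
    rw [delete_f_of_zero g (hloop e he), h3, (hco a ha).1] at h1 ⊢
    rcases h1 with h1 | h1
    · rcases h2 with h2 | h2 <;> rw [h2] at h1 <;> norm_num at h1
    · exact h1
  have htriple : ∀ a ∈ g.E, ∀ b ∈ g.E, ∀ c ∈ g.E, a ≠ b → a ≠ c → b ≠ c →
      g.f {a, b, c} = 1 := by
    intro a ha b hb c hcE hab hac hbc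
    have h := (hd a ha).2 _ (Finset.erase_subset _ _) _ (Finset.erase_subset _ _)
      (hcopair a ha b hb hab.symm) (hcopair a ha c hcE hac.symm)
    change (g.delete a).f (symmDiff ((g.E.erase a).erase b) ((g.E.erase a).erase c)) = 1 at h
    rwa [symmDiff_erase_erase (Finset.mem_erase.2 ⟨hab.symm, hb⟩)
      (Finset.mem_erase.2 ⟨hac.symm, hcE⟩) hbc, delete_f_of_zero g (hloop a ha), hpar b hb c hcE hbc, zero_add] at h
  obtain ⟨a, ha⟩ : g.E.Nonempty := by
    rw [Finset.nonempty_iff_ne_empty]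
    intro h
    exact hE (Or.inr (by rw [h, g.empty_one]))
  obtain ⟨b, hb, hba⟩ : ∃ b ∈ g.E, b ≠ a := by
    by_contra! h
    have h1 : g.E = {a} := Finset.eq_singleton_iff_unique_mem.2 ⟨ha, h⟩
    exact hE (Or.inl (by rw [h1]; exact hloop a ha))
  obtain ⟨c, hcE, hca, hcb⟩ : ∃ c ∈ g.E, c ≠ a ∧ c ≠ b := by
    by_contra! h
    have h1 : g.E.erase a = {b} :=
      Finset.eq_singleton_iff_unique_mem.2 ⟨Finset.mem_erase.2 ⟨hba, hb⟩,
        fun x hx => h x (Finset.mem_of_mem_erase hx) (Finset.ne_of_mem_erase hx)⟩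
    have h2 := (hco a ha).1
    rw [h1, hloop b hb] at h2
    exact zero_ne_one h2
  obtain ⟨d, hdE, hda, hdb, hdc⟩ : ∃ d ∈ g.E, d ≠ a ∧ d ≠ b ∧ d ≠ c := by
    by_contra! h
    have h1 : g.E.erase a = {b, c} := by
      clear hc hd hco hcopair htriple hloop hpar
      ext x; grind
    have h2 := (hco a ha).1
    rw [h1, hpar b hb c hcE hcb.symm] at h2
    exact zero_ne_one h2
  have hEeq : g.E = {a, b, c, d} := by
    by_contra hne
    have hss : ({a, b, c, d} : Finset α) ⊆ g.E := by
      simp [Finset.insert_subset_iff, ha, hb, hcE, hdE]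
    obtain ⟨x, hx, hx'⟩ := Finset.exists_of_ssubset (hss.ssubset_of_ne (Ne.symm hne))
    have hsx : ({a, b, c, d} : Finset α) ⊆ g.E.erase x := Finset.subset_erase.2 ⟨hss, hx'⟩
    have h := (hc x hx).2 {a, b, c} (subset_trans (by simp [Finset.insert_subset_iff]) hsx)
      {a, b, d} (subset_trans (by simp [Finset.insert_subset_iff]) hsx)
      (htriple a ha b hb c hcE hba.symm hca.symm hcb.symm)
      (htriple a ha b hb d hdE hba.symm hda.symm hdb.symm)
    rw [symmDiff_triple_triple hca hcb hda hdb hdc] at h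
    exact one_ne_zero (h.symm.trans (hpar c hcE d hdE hdc.symm))
  have hcard : ({a, b, c, d} : Finset α).card = 4 := by
    simp [hba.symm, hca.symm, hcb.symm, hda.symm, hdb.symm, hdc.symm]
  refine ⟨a, b, c, d, hcard, id, Set.injOn_id _, by simpa [fU24] using hEeq, fun X hX => ?_⟩
  have hXc : X.card ≤ 4 := by
    rw [← hcard, ← hEeq]
    exact Finset.card_le_card hX
  rw [Finset.image_id]
  simp only [fU24]
  have hcases : X.card = 0 ∨ X.card = 1 ∨ X.card = 2 ∨ X.card = 3 ∨ X.card = 4 := by omega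
  rcases hcases with h | h | h | h | h
  · rw [Finset.card_eq_zero] at h
    simp [h, g.empty_one]
  · obtain ⟨x, rfl⟩ := Finset.card_eq_one.1 h
    simp [hloop x (by simpa using hX)]
  · obtain ⟨x, y, hxy, rfl⟩ := Finset.card_eq_two.1 h
    simp [h, hpar x (hX (by simp)) y (hX (by simp)) hxy]
  · obtain ⟨x, y, z, hxy, hxz, hyz, rfl⟩ := Finset.card_eq_three.1 h
    simp [h, htriple x (hX (by simp)) y (hX (by simp)) z (hX (by simp)) hxy hxz hyz]
  · have hXE : X = g.E := Finset.eq_of_subset_of_card_le hX (by rw [h, hEeq, hcard])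
    rw [h, hXE, (hco a ha).2]
    norm_num

theorem Doubling.linear_of_no_fU24_minor {g : BinaryFunction α} (hg : g.Doubling)
    (hno : ¬ ∃ m : BinaryFunction α, IsMinorOf m g ∧
      ∃ a b c d : α, ({a, b, c, d} : Finset α).card = 4 ∧ m.Isomorphic (fU24 a b c d)) :
    g.Linear := by
  induction hn : g.E.card using Nat.strong_induction_on generalizing g with
  | _ n ih =>
    have hlt : ∀ e ∈ g.E, (g.E.erase e).card < n := fun e he =>
      hn ▸ Finset.card_erase_lt_of_mem he
    have hminor : ∀ {m : BinaryFunction α}, IsMinorOf m g → m.Doubling → m.E.card < n →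
        m.Linear := fun {m} hm hmd hlt => ih _ hlt hmd
          (fun ⟨m', hm', h⟩ => hno ⟨m', hm'.trans hm, h⟩) rfl
    have hc : ∀ e ∈ g.E, (g.contract e).Linear := fun e he =>
      hminor (.contract e he (.refl g)) (hg.contract e) (hlt e he)
    have hd : ∀ e ∈ g.E, (g.delete e).Linear := fun e he =>
      hminor (.delete e he (hg.one_add_pos he).ne' (.refl g)) (hg.delete he) (hlt e he)
    by_cases hloop : ∃ e ∈ g.E, g.f {e} = 1
    · obtain ⟨e, he, h1⟩ := hloop
      exact hg.linear_of_loop he h1 (hc e he)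
    have hloop0 : ∀ e ∈ g.E, g.f {e} = 0 := fun e he =>
      (hg.f_singleton he).resolve_right fun h => hloop ⟨e, he, h⟩
    by_cases hpar : ∃ a ∈ g.E, ∃ b ∈ g.E, a ≠ b ∧ g.f {a, b} = 1
    · obtain ⟨a, ha, b, hb, hab, h1⟩ := hpar
      exact linear_of_parallel ha hb hab (hloop0 a ha) (hloop0 b hb) h1 (hd a ha) (hd b hb)
        (hc a ha)
    have hpar0 : ∀ a ∈ g.E, ∀ b ∈ g.E, a ≠ b → g.f {a, b} = 0 := by
      intro a ha b hb hab
      have h := (hd a ha).1 {b}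
        (Finset.singleton_subset_iff.2 (Finset.mem_erase.2 ⟨hab.symm, hb⟩))
      rw [delete_f_of_zero g (hloop0 a ha), hloop0 b hb, zero_add] at h
      exact h.resolve_right fun h => hpar ⟨a, ha, b, hb, hab, h⟩
    by_cases hE : g.f g.E = 0 ∨ g.f g.E = 1
    · exact linear_of_simple hloop0 hpar0 hc hd hE
    · exact absurd ⟨g, .refl g, isomorphic_fU24_of_simple hloop0 hpar0 hc hd hE⟩ hno

end BinaryFunction

open BinaryFunction in
/-- A matroidal binary function is linear iff it has no minor isomorphic
to `f_{U_{2,4}}`. -/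
theorem matroidal_linear_iff_no_fU24_minor {α : Type} [DecidableEq α]
    (f : BinaryFunction α) (hm : f.Polymatroidal 1) :
    f.Linear ↔
      ¬ ∃ m : BinaryFunction α, IsMinorOf m f ∧
          ∃ a b c d : α, ({a, b, c, d} : Finset α).card = 4 ∧
            m.Isomorphic (fU24 a b c d) := by
  refine ⟨?_, hm.doubling.linear_of_no_fU24_minor⟩
  rintro hlin ⟨m, hmf, a, b, c, d, hcard, hiso⟩
  exact (Linear.of_isMinorOf hmf hlin).not_isomorphic_fU24 hcard hiso
end

section
/- For every finite set E and every function ρ from subsets of E to the reals with ρ(∅)=0, there exists a rankable binary function f on ground set E whose rank function Qf equals ρ. -/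
/-- Möbius inversion on finite sets: every function of finite sets is the sum over subsets of
some function. -/
theorem Finset.exists_sum_powerset_eq {α M : Type*} [DecidableEq α] [AddCommGroup M]
    (h : Finset α → M) : ∃ f : Finset α → M, ∀ X, ∑ Y ∈ X.powerset, f Y = h X := by
  let f : Finset α → M := Finset.strongInduction fun X f =>
    h X - ∑ Y ∈ X.ssubsets.attach, f Y (Finset.mem_ssubsets.1 Y.2)
  refine ⟨f, fun X => ?_⟩
  have hf : f X = h X - ∑ Y ∈ X.ssubsets, f Y := by
    rw [← Finset.sum_attach]
    exact Finset.strongInduction_eq _ X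
  rw [← Finset.sum_erase_add _ _ (Finset.mem_powerset_self X), hf]
  exact add_sub_cancel _ _

open BinaryFunction in
/-- For every finite ground set `E` and every `ρ : 2^E → ℝ` with
`ρ(∅) = 0`, there is a rankable binary function on `E` whose rank function is `ρ`. -/
theorem exists_rankable_with_rank {α : Type} [DecidableEq α]
    (E : Finset α) (ρ : Finset α → ℝ) (hρ : ρ ∅ = 0) :
    ∃ g : BinaryFunction α, g.E = E ∧ g.Rankable ∧ ∀ X ⊆ E, g.Q X = ρ X := by
  obtain ⟨f, hf⟩ := Finset.exists_sum_powerset_eq fun Y => (2 : ℝ) ^ (ρ E - ρ (E \ Y))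
  have f_empty : f ∅ = 1 := by simpa using hf ∅
  have quotient_eq : ∀ X ⊆ E,
      (∑ Y ∈ E.powerset, f Y) / ∑ Y ∈ (E \ X).powerset, f Y = 2 ^ ρ X := by
    intro X hX
    rw [hf, hf, ← Real.rpow_sub two_pos, Finset.sdiff_sdiff_eq_self hX, Finset.sdiff_self, hρ]
    congr 1
    ring
  refine ⟨⟨E, f, f_empty⟩, rfl, fun X hX => ⟨?_, ?_⟩, fun X hX => ?_⟩
  · rw [hf]
    positivity
  · rw [quotient_eq X hX]
    positivity
  · rw [Q, quotient_eq X hX, Real.logb_rpow two_pos (by norm_num)]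
end

section
/- The order-two binary function g on ground set {a,b}, defined by g(X)=1 for |X| ∈ {0,1} and g(X)=−1 for |X|=2, is an excluded minor for the class of linear binary functions: g is nonlinear, but every proper minor of g (i.e., g/a, g/b, g∖a, g∖b and their minors) is well defined and linear. -/
namespace BinaryFunction

variable {α : Type} [DecidableEq α]

/-- A `{0,1}`-valued binary function of order at most one is linear. -/
theorem linear_of_card_le_one {g : BinaryFunction α} (hcard : g.E.card ≤ 1)
    (hval : ∀ X ⊆ g.E, g.f X = 0 ∨ g.f X = 1) : g.Linear := by
  refine ⟨hval, fun X hX Y hY hfX hfY => ?_⟩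
  rcases X.eq_empty_or_nonempty with rfl | hXne
  · rwa [← Finset.bot_eq_empty, bot_symmDiff]
  rcases Y.eq_empty_or_nonempty with rfl | hYne
  · rwa [← Finset.bot_eq_empty, symmDiff_bot]
  have hXE : X = g.E := Finset.eq_of_subset_of_card_le hX (hcard.trans hXne.card_pos)
  have hYE : Y = g.E := Finset.eq_of_subset_of_card_le hY (hcard.trans hYne.card_pos)
  rw [hXE, hYE, symmDiff_self, Finset.bot_eq_empty, g.empty_one]

/-- Every binary function of order zero is linear. -/
theorem linear_of_ground_eq_empty {g : BinaryFunction α} (hE : g.E = ∅) : g.Linear := by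
  refine linear_of_card_le_one (by simp [hE]) fun X hX => Or.inr ?_
  rw [hE, Finset.subset_empty] at hX
  rw [hX, g.empty_one]

theorem not_linear_gTwo {a b : α} (hab : a ≠ b) : ¬ (gTwo a b).Linear := by
  intro h
  have := h.1 {a, b} subset_rfl
  norm_num [gTwo, Finset.card_pair hab] at this

theorem card_erase_gTwo {a b e : α} (hab : a ≠ b) (he : e ∈ (gTwo a b).E) :
    ((gTwo a b).E.erase e).card = 1 := by
  rw [Finset.card_erase_of_mem he]
  simp [gTwo, Finset.card_pair hab]

theorem linear_contract_gTwo {a b e : α} (hab : a ≠ b) (he : e ∈ (gTwo a b).E) :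
    ((gTwo a b).contract e).Linear := by
  refine linear_of_card_le_one (card_erase_gTwo hab he).le fun X hX => Or.inr ?_
  have hX1 : X.card ≤ 1 := (Finset.card_le_card hX).trans (card_erase_gTwo hab he).le
  exact if_neg (by omega)

theorem linear_delete_gTwo {a b e : α} (hab : a ≠ b) (he : e ∈ (gTwo a b).E) :
    ((gTwo a b).delete e).Linear := by
  refine linear_of_card_le_one (card_erase_gTwo hab he).le fun X hX => ?_
  rcases X.eq_empty_or_nonempty with rfl | hne
  · exact Or.inr (empty_one _)
  · have hX1 : X.card = 1 := le_antisymm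
      ((Finset.card_le_card hX).trans (card_erase_gTwo hab he).le) hne.card_pos
    have heX : e ∉ X := fun h => Finset.notMem_erase e _ (hX h)
    left
    simp [delete, gTwo, hX1, hne.ne_empty, Finset.union_singleton,
      Finset.card_insert_of_notMem heX]

/-- A minor of `gTwo a b` is `gTwo a b` itself or a linear function of order at most one. -/
theorem IsMinorOf.eq_gTwo_or_linear {a b : α} (hab : a ≠ b) {m : BinaryFunction α}
    (hm : IsMinorOf m (gTwo a b)) :
    m = gTwo a b ∨ m.E.card ≤ 1 ∧ m.Linear := by
  generalize hf : gTwo a b = f at hm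
  induction hm with
  | refl => exact Or.inl rfl
  | contract e he _ ih =>
    subst hf
    rcases ih rfl with rfl | ⟨hcard, hlin⟩
    · exact Or.inr ⟨(card_erase_gTwo hab he).le, linear_contract_gTwo hab he⟩
    · exact Or.inr ⟨Finset.card_erase_le.trans hcard, hlin.contract e⟩
  | delete e he _ _ ih =>
    subst hf
    rcases ih rfl with rfl | ⟨hcard, -⟩
    · exact Or.inr ⟨(card_erase_gTwo hab he).le, linear_delete_gTwo hab he⟩
    · refine Or.inr ⟨Finset.card_erase_le.trans hcard,
        linear_of_ground_eq_empty (Finset.card_eq_zero.mp ?_)⟩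
      have := Finset.card_erase_of_mem he
      simp only [BinaryFunction.delete]
      omega

end BinaryFunction

open BinaryFunction in
/-- The order-two function `g` is an excluded minor for the linear binary
functions: it is nonlinear, but every proper minor of it is well defined and linear. -/
theorem gTwo_excluded_minor {α : Type} [DecidableEq α] (a b : α) (hab : a ≠ b) :
    ¬ (gTwo a b).Linear ∧
    ∀ m : BinaryFunction α, IsMinorOf m (gTwo a b) →
      m.E.card < (gTwo a b).E.card → m.Linear := by
  refine ⟨not_linear_gTwo hab, fun m hm hlt => ?_⟩
  rcases hm.eq_gTwo_or_linear hab with rfl | ⟨-, hlin⟩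
  · exact absurd hlt (lt_irrefl _)
  · exact hlin
end
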